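/- Let μ ∈ ℤⁿ, let y₁ = τ_α(y(p,e,b,g)) for some p ∈ ℂ, e ∈ ℂ×, b, g ∈ ℂ^{k−1}, and let y₂ ∈ Gr_{μ+α}. Then there exist n ∈ N^α[t] and n₋ ∈ N₋[t] such that n·y₁·y₂·n₋ ∈ Gr_μ. -/

import Mathlib

open Matrix

noncomputable section

/-- `K = ℂ((t⁻¹))`, the field of formal Laurent series in `t⁻¹`.  We realize it as
`LaurentSeries ℂ`, where the Laurent-series variable `X` plays the role of `t⁻¹`;
thus for `f : K`, `f.coeff j` is the coefficient of `t^{-j}`. -/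
abbrev K : Type := LaurentSeries ℂ

/-- The element `t` (the inverse of the Laurent series variable). -/
def tK : K := (HahnSeries.single (-1 : ℤ) (1 : ℂ))

/-- The constant embedding `ℂ → K`. -/
def Cc (z : ℂ) : K := HahnSeries.C z

/-- `f ∈ 𝒪 = ℂ[[t⁻¹]]` : no positive powers of `t`. -/
def memO (f : K) : Prop := ∀ j : ℤ, j < 0 → f.coeff j = 0

/-- `f ∈ 𝒪₁ = t⁻¹ℂ[[t⁻¹]]`. -/
def memO1 (f : K) : Prop := ∀ j : ℤ, j ≤ 0 → f.coeff j = 0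

/-- `f ∈ ℂ[t]`. -/
def memPoly (f : K) : Prop := ∀ j : ℤ, 0 < j → f.coeff j = 0

/-- Upper unitriangular matrix. -/
def IsUpperUni {R : Type*} [Zero R] [One R] {m : ℕ} (M : Matrix (Fin m) (Fin m) R) : Prop :=
  (∀ i, M i i = 1) ∧ ∀ i j : Fin m, j < i → M i j = 0

/-- Lower unitriangular matrix. -/
def IsLowerUni {R : Type*} [Zero R] [One R] {m : ℕ} (M : Matrix (Fin m) (Fin m) R) : Prop :=
  (∀ i, M i i = 1) ∧ ∀ i j : Fin m, i < j → M i j = 0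

/-- `M ∈ N₁[[t⁻¹]]` : upper unitriangular with off-diagonal entries in `𝒪₁`. -/
def MemN1 {m : ℕ} (M : Matrix (Fin m) (Fin m) K) : Prop :=
  IsUpperUni M ∧ ∀ i j : Fin m, i ≠ j → memO1 (M i j)

/-- `M ∈ N₋,₁[[t⁻¹]]`. -/
def MemN1neg {m : ℕ} (M : Matrix (Fin m) (Fin m) K) : Prop :=
  IsLowerUni M ∧ ∀ i j : Fin m, i ≠ j → memO1 (M i j)

/-- `M ∈ T₁[[t⁻¹]]` : diagonal with entries in `1 + 𝒪₁`. -/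
def MemT1 {m : ℕ} (M : Matrix (Fin m) (Fin m) K) : Prop :=
  (∀ i j : Fin m, i ≠ j → M i j = 0) ∧ ∀ i, memO1 (M i i - 1)

/-- `M ∈ N[t]` : upper unitriangular with entries in `ℂ[t]`. -/
def MemNpoly {m : ℕ} (M : Matrix (Fin m) (Fin m) K) : Prop :=
  IsUpperUni M ∧ ∀ i j : Fin m, memPoly (M i j)

/-- `M ∈ N₋[t]` : lower unitriangular with entries in `ℂ[t]`. -/
def MemNnegPoly {m : ℕ} (M : Matrix (Fin m) (Fin m) K) : Prop :=
  IsLowerUni M ∧ ∀ i j : Fin m, memPoly (M i j)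

/-- `t^ν = diag(t^{ν₁},…,t^{ν_m})`. -/
def tPow {m : ℕ} (ν : Fin m → ℤ) : Matrix (Fin m) (Fin m) K :=
  Matrix.diagonal fun i => tK ^ ν i

/-- `y = u · h · t^ν · l` is a Gauss factorization exhibiting membership in `Gr_ν`. -/
def IsGauss {m : ℕ} (ν : Fin m → ℤ) (y u h l : Matrix (Fin m) (Fin m) K) : Prop :=
  MemN1 u ∧ MemT1 h ∧ MemN1neg l ∧ y = u * h * tPow ν * l

/-- The matrix slice `Gr_ν = N₁[[t⁻¹]]·T₁[[t⁻¹]]·t^ν·N₋,₁[[t⁻¹]]`. -/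
def GrSlice {m : ℕ} (ν : Fin m → ℤ) : Set (Matrix (Fin m) (Fin m) K) :=
  { y | ∃ u h l, IsGauss ν y u h l }

/-- Block embedding `τ_α : Mat_{k+1} → Mat_n` into (1-indexed) rows and columns `r₁,…,r₁+k`,
identity outside this block. -/
def blockEmbed {R : Type*} [Zero R] [One R] (n r₁ k : ℕ)
    (g : Matrix (Fin (k+1)) (Fin (k+1)) R) : Matrix (Fin n) (Fin n) R :=
  fun i j =>
    if h : r₁ - 1 ≤ (i : ℕ) ∧ (i : ℕ) ≤ r₁ - 1 + k ∧ r₁ - 1 ≤ (j : ℕ) ∧ (j : ℕ) ≤ r₁ - 1 + k then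
      g ⟨(i : ℕ) - (r₁ - 1), by omega⟩ ⟨(j : ℕ) - (r₁ - 1), by omega⟩
    else if i = j then 1 else 0

/-- The coweight `α` of `PGL_n` : `α_{r₁} = 1`, `α_{r₂+1} = -1` (1-indexed), all other
entries `0`. -/
def alphaCo (n r₁ r₂ : ℕ) : Fin n → ℤ :=
  fun i => if (i : ℕ) = r₁ - 1 then 1 else if (i : ℕ) = r₂ then -1 else 0

/-- The matrix `y(p,e,b,g)` (matrix representative of a point of the open Zastava
`Gr⁰_{-α}`), a `(k+1)×(k+1)` matrix over `ℂ[t] ⊆ K`. -/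
def ymat (k : ℕ) (p e : ℂ) (b g : Fin (k-1) → ℂ) :
    Matrix (Fin (k+1)) (Fin (k+1)) K :=
  fun i j =>
    if _hi0 : (i : ℕ) = 0 then
      (if _hjk : (j : ℕ) = k then Cc e else 0)
    else if _hik : (i : ℕ) = k then
      (if _hj0 : (j : ℕ) = 0 then Cc (-e⁻¹)
       else if _hjk : (j : ℕ) = k then tK - Cc (p + ∑ l : Fin (k-1), b l * g l)
       else Cc (-(g ⟨k - (j : ℕ) - 1, by have := j.isLt; omega⟩)))
    else
      (if _hji : (j : ℕ) = (i : ℕ) then 1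
       else if _hjk : (j : ℕ) = k then Cc (b ⟨k - (i : ℕ) - 1, by have := i.isLt; omega⟩)
       else 0)

/-- The matrix `x₋(v)` over `K` : identity except for the bottom row `(v_k,…,v₁,1)`. -/
def xminusK (k : ℕ) (v : Fin k → ℂ) : Matrix (Fin (k+1)) (Fin (k+1)) K :=
  fun i j =>
    if _hik : (i : ℕ) = k then
      (if _hjk : (j : ℕ) = k then 1 else Cc (v ⟨k - (j : ℕ) - 1, by have := j.isLt; omega⟩))
    else if i = j then 1 else 0

/-- `Φ_α(y)` read off from the `N₁[[t⁻¹]]`-factor `u` of a Gauss factorization of `y`. -/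
def PhiOf (n r₂ k : ℕ) (hrn : r₂ < n) (u : Matrix (Fin n) (Fin n) K) : Fin k → ℂ :=
  fun a => (u ⟨r₂ - 1 - (a : ℕ), by omega⟩ ⟨r₂, hrn⟩).coeff 1

/-- `ζ_α(y)` read off from the `N₁[[t⁻¹]]`-factor `u` of a Gauss factorization of `y`. -/
def ZetaOf (n r₁ r₂ k : ℕ) (hr1 : 1 ≤ r₁) (hrr : r₁ ≤ r₂) (hrn : r₂ < n)
    (hk : k = r₂ - r₁ + 1) (u : Matrix (Fin n) (Fin n) K) : Fin k → ℂ :=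
  fun a =>
    if _ha : (a : ℕ) = k - 1 then (u ⟨r₁ - 1, by omega⟩ ⟨r₂, hrn⟩).coeff 2
    else (u ⟨r₁ - 1, by omega⟩ ⟨r₁ + (a : ℕ), by have := a.isLt; omega⟩).coeff 1

/-- `ξ_α(y)`, computed from the `N₁[[t⁻¹]]`-factor `u` of a Gauss factorization of `y`. -/
def xiOf (n r₁ r₂ k : ℕ) (hr1 : 1 ≤ r₁) (hrr : r₁ ≤ r₂) (hrn : r₂ < n)
    (hk : k = r₂ - r₁ + 1) (u : Matrix (Fin n) (Fin n) K) : Matrix (Fin n) (Fin n) K :=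
  let c := PhiOf n r₂ k hrn u
  let z := ZetaOf n r₁ r₂ k hr1 hrr hrn hk u
  let e : ℂ := c ⟨k - 1, by omega⟩
  let b : Fin (k-1) → ℂ := fun i => c ⟨(i : ℕ), by have := i.isLt; omega⟩
  let g : Fin (k-1) → ℂ := fun i => z ⟨k - (i : ℕ) - 2, by omega⟩ / e
  let p : ℂ := z ⟨k - 1, by omega⟩ / e - ∑ i : Fin (k-1), b i * g i
  blockEmbed n r₁ k (ymat k p e b g)

/-- `M` has identity submatrix in (1-indexed) rows and columns `r₁,…,r₁+k`. -/
def HasIdBlock {R : Type*} [Zero R] [One R] {n : ℕ} (r₁ k : ℕ)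
    (M : Matrix (Fin n) (Fin n) R) : Prop :=
  ∀ i j : Fin n, r₁ - 1 ≤ (i : ℕ) → (i : ℕ) ≤ r₁ - 1 + k →
    r₁ - 1 ≤ (j : ℕ) → (j : ℕ) ≤ r₁ - 1 + k →
    M i j = if i = j then 1 else 0

/-- `M ∈ N^α(K)` : upper unitriangular over `K` with identity `(k+1)×(k+1)`-block. -/
def MemNalphaK (n r₁ k : ℕ) (M : Matrix (Fin n) (Fin n) K) : Prop :=
  IsUpperUni M ∧ HasIdBlock r₁ k M

/-- `M ∈ N^α[t]`. -/
def MemNalphaPoly (n r₁ k : ℕ) (M : Matrix (Fin n) (Fin n) K) : Prop :=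
  MemNalphaK n r₁ k M ∧ ∀ i j : Fin n, memPoly (M i j)

/-- `M ∈ N(K)^α₁ = x_α(N_{1,k+1}[[t⁻¹]])·N^α(K)`. -/
def MemNKalpha1 (n r₁ k : ℕ) (M : Matrix (Fin n) (Fin n) K) : Prop :=
  ∃ (a : Matrix (Fin (k+1)) (Fin (k+1)) K) (u : Matrix (Fin n) (Fin n) K),
    MemN1 a ∧ MemNalphaK n r₁ k u ∧ M = blockEmbed n r₁ k a * u

/-- `z = π(x)` for the slice `Gr_ν` : `z ∈ Gr_ν` and `z = a·x·b` with `a ∈ N[t]`,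
`b ∈ N₋[t]`. -/
def IsPiOf {n : ℕ} (ν : Fin n → ℤ) (x z : Matrix (Fin n) (Fin n) K) : Prop :=
  z ∈ GrSlice ν ∧ ∃ a b, MemNpoly a ∧ MemNnegPoly b ∧ z = a * x * b

/-- The open Zastava slice `Gr⁰_{-α} ⊆ GL_n(K)` : matrices `τ_α(y(p,e,b,g))`. -/
def GrZeroNegAlpha (n r₁ k : ℕ) : Set (Matrix (Fin n) (Fin n) K) :=
  { M | ∃ (p e : ℂ) (b g : Fin (k-1) → ℂ), e ≠ 0 ∧ M = blockEmbed n r₁ k (ymat k p e b g) }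

/-- `μ + α`. -/
def addAlpha (n r₁ r₂ : ℕ) (μ : Fin n → ℤ) : Fin n → ℤ :=
  fun i => μ i + alphaCo n r₁ r₂ i


/-- `f` has no terms in `t` of degree greater than `-m`. -/
def OrdGE (m : ℤ) (f : K) : Prop := ∀ j : ℤ, j < m → f.coeff j = 0

theorem memO1_iff_ordGE {f : K} : memO1 f ↔ OrdGE 1 f :=
  ⟨fun h j hj => h j (by omega), fun h j hj => h j (by omega)⟩

theorem OrdGE.mono {a b : ℤ} {f : K} (h : OrdGE a f) (hab : b ≤ a) : OrdGE b f :=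
  fun j hj => h j (by omega)

theorem OrdGE.mul {a b : ℤ} {f g : K} (hf : OrdGE a f) (hg : OrdGE b g) :
    OrdGE (a + b) (f * g) := by
  intro j hj
  rw [HahnSeries.coeff_mul]
  refine Finset.sum_eq_zero fun x hx => ?_
  have hx := (Finset.mem_antidiagonal.1 hx).2.2
  by_cases h : x.1 < a
  · rw [hf _ h, zero_mul]
  · rw [hg _ (by omega), mul_zero]

theorem OrdGE.add {a : ℤ} {f g : K} (hf : OrdGE a f) (hg : OrdGE a g) : OrdGE a (f + g) := by
  intro j hj
  rw [HahnSeries.coeff_add, hf j hj, hg j hj, add_zero]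

theorem OrdGE.neg {a : ℤ} {f : K} (hf : OrdGE a f) : OrdGE a (-f) := by
  intro j hj
  rw [HahnSeries.coeff_neg, hf j hj, neg_zero]

theorem OrdGE.sub {a : ℤ} {f g : K} (hf : OrdGE a f) (hg : OrdGE a g) : OrdGE a (f - g) := by
  rw [sub_eq_add_neg]; exact hf.add hg.neg

theorem ordGE_zero (a : ℤ) : OrdGE a (0 : K) := fun _ _ => HahnSeries.coeff_zero

theorem OrdGE.sum {ι : Type*} {a : ℤ} {f : ι → K} {s : Finset ι}
    (h : ∀ i ∈ s, OrdGE a (f i)) : OrdGE a (∑ i ∈ s, f i) :=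
  Finset.sum_induction _ (OrdGE a) (fun _ _ => OrdGE.add) (ordGE_zero a) h

theorem ordGE_single (a : ℤ) (z : ℂ) : OrdGE a (HahnSeries.single a z) :=
  fun _ hj => HahnSeries.coeff_single_of_ne (by omega)

theorem ordGE_Cc (z : ℂ) : OrdGE 0 (Cc z) := ordGE_single 0 z

theorem ordGE_one : OrdGE 0 (1 : K) := ordGE_single 0 1

theorem tK_ne_zero : tK ≠ 0 := HahnSeries.single_ne_zero one_ne_zero

theorem inv_tK : tK⁻¹ = HahnSeries.single 1 1 := by
  refine inv_eq_of_mul_eq_one_right ?_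
  rw [tK, HahnSeries.single_mul_single]
  norm_num

theorem ordGE_inv_tK : OrdGE 1 tK⁻¹ := by
  rw [inv_tK]; exact ordGE_single _ _

theorem OrdGE.of_sub_one {f : K} (h : OrdGE 1 (f - 1)) : OrdGE 0 f := by
  simpa using (h.mono zero_le_one).add ordGE_one

theorem ne_zero_of_sub_one {f : K} (h : OrdGE 1 (f - 1)) : f ≠ 0 := by
  rintro rfl
  simpa using h 0 zero_lt_one

theorem OrdGE.inv_sub_one {f : K} (h : OrdGE 1 (f - 1)) : OrdGE 1 (f⁻¹ - 1) := by
  have hf := ne_zero_of_sub_one h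
  have hc : f.coeff 0 = 1 := by
    have := h 0 zero_lt_one
    rw [HahnSeries.coeff_sub, HahnSeries.coeff_one, if_pos rfl] at this
    exact sub_eq_zero.1 this
  have h1 : f.order ≤ 0 := HahnSeries.order_le_of_coeff_ne_zero (by rw [hc]; exact one_ne_zero)
  have h2 : f.order + f⁻¹.order = 0 := by
    rw [← HahnSeries.order_mul hf (inv_ne_zero hf), mul_inv_cancel₀ hf, HahnSeries.order_one]
  have h3 : OrdGE 0 f⁻¹ := fun j hj => HahnSeries.coeff_eq_zero_of_lt_order (by omega)
  have h4 : f⁻¹ - 1 = -((f - 1) * f⁻¹) := by field_simp; ring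
  rw [h4]
  exact (h.mul h3).neg

theorem OrdGE.mul_sub_one {f g : K} (hf : OrdGE 1 (f - 1)) (hg : OrdGE 1 (g - 1)) :
    OrdGE 1 (f * g - 1) := by
  have : f * g - 1 = (f - 1) * g + (g - 1) := by ring
  rw [this]
  exact (hf.mul hg.of_sub_one).add hg

theorem memPoly.mul {f g : K} (hf : memPoly f) (hg : memPoly g) : memPoly (f * g) := by
  intro j hj
  rw [HahnSeries.coeff_mul]
  refine Finset.sum_eq_zero fun x hx => ?_
  have hx := (Finset.mem_antidiagonal.1 hx).2.2
  by_cases h : 0 < x.1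
  · rw [hf _ h, zero_mul]
  · rw [hg _ (by omega), mul_zero]

theorem memPoly.add {f g : K} (hf : memPoly f) (hg : memPoly g) : memPoly (f + g) := by
  intro j hj
  rw [HahnSeries.coeff_add, hf j hj, hg j hj, add_zero]

theorem memPoly_zero : memPoly (0 : K) := fun _ _ => HahnSeries.coeff_zero

theorem memPoly_one : memPoly (1 : K) :=
  fun _ hj => HahnSeries.coeff_single_of_ne (by omega)

theorem memPoly.sum {ι : Type*} {f : ι → K} {s : Finset ι}
    (h : ∀ i ∈ s, memPoly (f i)) : memPoly (∑ i ∈ s, f i) :=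
  Finset.sum_induction _ memPoly (fun _ _ => memPoly.add) memPoly_zero h

theorem eq_zero_of_memPoly_of_memO1 {f : K} (hf : memPoly f) (hg : memO1 f) : f = 0 := by
  ext j
  rcases le_or_gt j 0 with h | h
  · exact hg j h
  · exact hf j h

/-- The decomposition `K = ℂ[t] ⊕ 𝒪₁`. -/
theorem exists_memPoly_add_memO1 (f : K) : ∃ q : K, memPoly q ∧ memO1 (f + q) := by
  let g : K := HahnSeries.ofSuppBddBelow (fun j => if j ≤ 0 then 0 else f.coeff j)
    ⟨0, fun j hj => by
      by_contra h
      exact hj (if_pos (by omega))⟩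
  have hg : ∀ j, g.coeff j = if j ≤ 0 then 0 else f.coeff j := fun j => rfl
  refine ⟨g - f, fun j hj => ?_, fun j hj => ?_⟩
  · rw [HahnSeries.coeff_sub, hg, if_neg (by omega), sub_self]
  · rw [add_sub_cancel, hg, if_pos hj]

section Unitriangular

variable {R : Type*} [CommRing R] {m : ℕ}

theorem isUpperUni_one : IsUpperUni (1 : Matrix (Fin m) (Fin m) R) :=
  ⟨fun i => one_apply_eq i, fun _ _ h => one_apply_ne h.ne'⟩

theorem isLowerUni_one : IsLowerUni (1 : Matrix (Fin m) (Fin m) R) :=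
  ⟨fun i => one_apply_eq i, fun _ _ h => one_apply_ne h.ne⟩

theorem isLowerUni_transpose {M : Matrix (Fin m) (Fin m) R} : IsLowerUni Mᵀ ↔ IsUpperUni M :=
  ⟨fun h => ⟨h.1, fun i j hij => h.2 j i hij⟩, fun h => ⟨h.1, fun i j hij => h.2 j i hij⟩⟩

theorem isUpperUni_transpose {M : Matrix (Fin m) (Fin m) R} : IsUpperUni Mᵀ ↔ IsLowerUni M :=
  ⟨fun h => ⟨h.1, fun i j hij => h.2 j i hij⟩, fun h => ⟨h.1, fun i j hij => h.2 j i hij⟩⟩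

theorem IsUpperUni.blockTriangular {M : Matrix (Fin m) (Fin m) R} (h : IsUpperUni M) :
    M.BlockTriangular id := fun i j hij => h.2 i j hij

theorem IsUpperUni.mul {M N : Matrix (Fin m) (Fin m) R} (hM : IsUpperUni M)
    (hN : IsUpperUni N) : IsUpperUni (M * N) := by
  refine ⟨fun i => ?_, fun i j hij => (hM.blockTriangular.mul hN.blockTriangular) hij⟩
  rw [mul_apply, Finset.sum_eq_single i]
  · rw [hM.1, hN.1, one_mul]
  · intro j _ hj
    rcases lt_or_gt_of_ne hj with h | h
    · rw [hM.2 i j h, zero_mul]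
    · rw [hN.2 j i h, mul_zero]
  · simp

theorem IsUpperUni.det {M : Matrix (Fin m) (Fin m) R} (hM : IsUpperUni M) : M.det = 1 := by
  rw [det_of_isUpperTriangular hM.blockTriangular]
  exact Finset.prod_eq_one fun i _ => hM.1 i

theorem IsUpperUni.isUnit {M : Matrix (Fin m) (Fin m) R} (hM : IsUpperUni M) : IsUnit M.det :=
  hM.det ▸ isUnit_one

theorem IsUpperUni.inv {M : Matrix (Fin m) (Fin m) R} (hM : IsUpperUni M) : IsUpperUni M⁻¹ := by
  have := invertibleOfIsUnitDet M hM.isUnit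
  have hB : M⁻¹.BlockTriangular id := blockTriangular_inv_of_blockTriangular hM.blockTriangular
  refine ⟨fun i => ?_, fun i j hij => hB hij⟩
  have h := congrFun (congrFun (mul_nonsing_inv M hM.isUnit) i) i
  rw [mul_apply, Finset.sum_eq_single i, hM.1, one_mul, one_apply_eq] at h
  · exact h
  · intro j _ hj
    rcases lt_or_gt_of_ne hj with h | h
    · rw [hM.2 i j h, zero_mul]
    · rw [hB h, mul_zero]
  · simp

theorem IsLowerUni.mul {M N : Matrix (Fin m) (Fin m) R} (hM : IsLowerUni M)
    (hN : IsLowerUni N) : IsLowerUni (M * N) := by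
  rw [← isUpperUni_transpose, transpose_mul]
  exact (isUpperUni_transpose.2 hN).mul (isUpperUni_transpose.2 hM)

theorem IsLowerUni.isUnit {M : Matrix (Fin m) (Fin m) R} (hM : IsLowerUni M) :
    IsUnit M.det := by
  rw [← det_transpose]; exact (isUpperUni_transpose.2 hM).isUnit

theorem IsLowerUni.inv {M : Matrix (Fin m) (Fin m) R} (hM : IsLowerUni M) : IsLowerUni M⁻¹ := by
  rw [← isUpperUni_transpose, transpose_nonsing_inv]
  exact (isUpperUni_transpose.2 hM).inv

/-- Conjugating a lower unitriangular matrix by an invertible diagonal matrix. -/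
theorem IsLowerUni.conj_diagonal {M : Matrix (Fin m) (Fin m) R} (hM : IsLowerUni M)
    {d d' : Fin m → R} (hd : ∀ i, d i * d' i = 1) :
    IsLowerUni (diagonal d * M * diagonal d') := by
  refine ⟨fun i => ?_, fun i j hij => ?_⟩
  · rw [mul_diagonal, diagonal_mul, hM.1, mul_one, hd]
  · rw [mul_diagonal, diagonal_mul, hM.2 i j hij, mul_zero, zero_mul]

/-- The diagonal blocks of a product of block triangular matrices depend only on the diagonal
blocks of the factors. -/
theorem blockTriangular_mul_congr {ι : Type*} [LinearOrder ι] {β : Fin m → ι}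
    {X X' Y Y' : Matrix (Fin m) (Fin m) R}
    (hX : X.BlockTriangular β) (hX' : X'.BlockTriangular β)
    (hY : Y.BlockTriangular β) (hY' : Y'.BlockTriangular β)
    (hXX : ∀ i j, β i = β j → X i j = X' i j) (hYY : ∀ i j, β i = β j → Y i j = Y' i j) :
    ∀ i j, β i = β j → (X * Y) i j = (X' * Y') i j := by
  intro i j hij
  rw [mul_apply, mul_apply]
  refine Finset.sum_congr rfl fun l _ => ?_
  rcases lt_trichotomy (β l) (β i) with h | h | h
  · rw [hX h, hX' h, zero_mul, zero_mul]
  · rw [hXX i l h.symm, hYY l j (h.trans hij)]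
  · rw [hY (hij ▸ h), hY' (hij ▸ h), mul_zero, mul_zero]

theorem IsUpperUni.blockTriangular_of_monotone {ι : Type*} [LinearOrder ι] {β : Fin m → ι}
    (hβ : Monotone β) {M : Matrix (Fin m) (Fin m) R} (h : IsUpperUni M) :
    M.BlockTriangular β := fun i j hij => h.2 i j (hβ.reflect_lt hij)

end Unitriangular

section Factorization

variable {m : ℕ}

theorem MemNpoly.mul {M N : Matrix (Fin m) (Fin m) K} (hM : MemNpoly M) (hN : MemNpoly N) :
    MemNpoly (M * N) :=
  ⟨hM.1.mul hN.1, fun i j => by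
    rw [mul_apply]; exact memPoly.sum fun l _ => (hM.2 i l).mul (hN.2 l j)⟩

theorem MemN1.ordGE {M : Matrix (Fin m) (Fin m) K} (hM : MemN1 M) {i j : Fin m} (h : i ≠ j) :
    OrdGE 1 (M i j) := memO1_iff_ordGE.1 (hM.2 i j h)

theorem MemN1.ordGE_zero {M : Matrix (Fin m) (Fin m) K} (hM : MemN1 M) (i j : Fin m) :
    OrdGE 0 (M i j) := by
  by_cases h : i = j
  · rw [h, hM.1.1]; exact ordGE_one
  · exact (hM.ordGE h).mono zero_le_one

theorem MemN1.mul {M N : Matrix (Fin m) (Fin m) K} (hM : MemN1 M) (hN : MemN1 N) :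
    MemN1 (M * N) := by
  refine ⟨hM.1.mul hN.1, fun i j hij => memO1_iff_ordGE.2 ?_⟩
  rw [mul_apply]
  refine OrdGE.sum fun l _ => ?_
  by_cases h : i = l
  · subst h
    exact (hM.ordGE_zero i i).mul (hN.ordGE hij)
  · exact (hM.ordGE h).mul (hN.ordGE_zero l j)

theorem memN1_one : MemN1 (1 : Matrix (Fin m) (Fin m) K) :=
  ⟨isUpperUni_one, fun i j h => by rw [one_apply_ne h]; exact fun _ _ => HahnSeries.coeff_zero⟩

/-- `N(K) = N[t] · N₁[[t⁻¹]]`. -/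
theorem IsUpperUni.exists_memNpoly_mul {U : Matrix (Fin m) (Fin m) K} (hU : IsUpperUni U) :
    ∃ a, MemNpoly a ∧ MemN1 (a * U) := by
  have key : ∀ d : ℕ, ∃ a, MemNpoly a ∧
      ∀ i j : Fin m, i < j → (j : ℕ) ≤ i + d → memO1 ((a * U : Matrix (Fin m) (Fin m) K) i j) := by
    intro d
    induction d with
    | zero =>
      refine ⟨1, ⟨isUpperUni_one, fun i j => ?_⟩, fun i j h h' => ?_⟩
      · rw [one_apply]; split_ifs
        exacts [memPoly_one, memPoly_zero]
      · have : (i : ℕ) < j := h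
        omega
    | succ d ih =>
      obtain ⟨a, ha, had⟩ := ih
      have hV := ha.1.mul hU
      set V := a * U with hVdef
      choose q hq1 hq2 using fun i j => exists_memPoly_add_memO1 (V i j)
      let P : Matrix (Fin m) (Fin m) K := fun i j => if (j : ℕ) = i + (d + 1) then q i j else 0
      have hP : ∀ i j : Fin m, (j : ℕ) ≠ i + (d + 1) → P i j = 0 := fun i j h => if_neg h
      have hP' : ∀ i j : Fin m, (j : ℕ) = i + (d + 1) → P i j = q i j := fun i j h => if_pos h
      have h1P : MemNpoly (1 + P) := by
        refine ⟨⟨fun i => ?_, fun i j h => ?_⟩, fun i j => ?_⟩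
        · rw [Matrix.add_apply, one_apply_eq, hP i i (by omega), add_zero]
        · have : (j : ℕ) < i := h
          rw [Matrix.add_apply, one_apply_ne h.ne', hP i j (by omega), add_zero]
        · rw [Matrix.add_apply]
          refine memPoly.add ?_ ?_
          · rw [one_apply]; split_ifs
            exacts [memPoly_one, memPoly_zero]
          · by_cases h : (j : ℕ) = i + (d + 1)
            · rw [hP' i j h]; exact hq1 i j
            · rw [hP i j h]; exact memPoly_zero
      refine ⟨(1 + P) * a, h1P.mul ha, fun i j hij hd => ?_⟩
      rw [mul_assoc, ← hVdef, add_mul, one_mul, Matrix.add_apply, mul_apply]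
      by_cases h : (j : ℕ) = i + (d + 1)
      · rw [Finset.sum_eq_single j, hP' i j h, hV.1, mul_one]
        · exact hq2 i j
        · intro l _ hl
          rw [hP i l (fun h' => hl (Fin.ext (by omega))), zero_mul]
        · simp
      · rw [Finset.sum_eq_zero, add_zero]
        · exact had i j hij (by omega)
        · intro l _
          by_cases h' : (l : ℕ) = i + (d + 1)
          · rw [hV.2 l j (Fin.lt_def.2 (by omega)), mul_zero]
          · rw [hP i l h', zero_mul]
  obtain ⟨a, ha, had⟩ := key m
  refine ⟨a, ha, ha.1.mul hU, fun i j hij => ?_⟩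
  rcases lt_or_gt_of_ne hij with h | h
  · exact had i j h (by omega)
  · rw [(ha.1.mul hU).2 i j h]
    exact fun _ _ => HahnSeries.coeff_zero

/-- `N₋(K) = N₋,₁[[t⁻¹]] · N₋[t]`. -/
theorem IsLowerUni.exists_mul_memNnegPoly {L : Matrix (Fin m) (Fin m) K} (hL : IsLowerUni L) :
    ∃ c, MemNnegPoly c ∧ MemN1neg (L * c) := by
  obtain ⟨a, ha, haL⟩ := (isUpperUni_transpose.2 hL).exists_memNpoly_mul
  have h : (a * Lᵀ)ᵀ = L * aᵀ := by rw [transpose_mul, transpose_transpose]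
  refine ⟨aᵀ, ⟨isLowerUni_transpose.2 ha.1, fun i j => ha.2 j i⟩, ?_⟩
  rw [← h]
  exact ⟨isLowerUni_transpose.2 haL.1, fun i j hij => haL.2 j i hij.symm⟩

/-- Matrices over `𝒪` whose reduction modulo `𝒪₁` is lower unitriangular. -/
def ReducesToLowerUni (M : Matrix (Fin m) (Fin m) K) : Prop :=
  (∀ i j, OrdGE 0 (M i j)) ∧ (∀ i j, i < j → OrdGE 1 (M i j)) ∧ ∀ i, OrdGE 1 (M i i - 1)

/-- Gauss elimination for matrices over `𝒪` with lower unitriangular reduction. -/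
theorem ReducesToLowerUni.exists_gauss {M : Matrix (Fin m) (Fin m) K}
    (hM : ReducesToLowerUni M) :
    ∃ V L, MemN1 V ∧ IsLowerUni L ∧ MemT1 (V * M * L) := by
  have key : ∀ d : ℕ, d ≤ m → ∃ V L, MemN1 V ∧ IsLowerUni L ∧ ReducesToLowerUni (V * M * L) ∧
      ∀ i j : Fin m, i ≠ j → (m - d ≤ (i : ℕ) ∨ m - d ≤ (j : ℕ)) → (V * M * L : Matrix (Fin m) (Fin m) K) i j = 0 := by
    intro d
    induction d with
    | zero =>
      intro _
      refine ⟨1, 1, memN1_one, isLowerUni_one, ?_, fun i j _ h => by omega⟩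
      simpa using hM
    | succ d ih =>
      intro hd
      obtain ⟨V, L, hV, hL, hN, hz⟩ := ih (by omega)
      set N := V * M * L with hNdef
      let q : Fin m := ⟨m - (d + 1), by omega⟩
      have hd1 := hN.2.2 q
      have hd0 := ne_zero_of_sub_one hd1
      have hdi := hd1.inv_sub_one.of_sub_one
      let v : Fin m → K := fun i => if i < q then -(N i q * (N q q)⁻¹) else 0
      let w : Fin m → K := fun j => if j < q then -((N q q)⁻¹ * N q j) else 0
      have hv : ∀ i, OrdGE 1 (v i) := by
        intro i
        simp only [v]
        split_ifs with h
        · exact ((hN.2.1 i q h).mul hdi).neg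
        · exact ordGE_zero 1
      have hw : ∀ i, OrdGE 0 (w i) := by
        intro i
        simp only [w]
        split_ifs with h
        · exact (hdi.mul (hN.1 q i)).neg
        · exact ordGE_zero 0
      have hv0 : ∀ i, q ≤ i → v i = 0 := fun i h => if_neg (not_lt.2 h)
      have hw0 : ∀ i, q ≤ i → w i = 0 := fun i h => if_neg (not_lt.2 h)
      let V' : Matrix (Fin m) (Fin m) K := 1 + vecMulVec v (Pi.single q 1)
      let L' : Matrix (Fin m) (Fin m) K := 1 + vecMulVec (Pi.single q 1) w
      have hV' : ∀ i j, V' i j = (if i = j then 1 else 0) + (if j = q then v i else 0) := by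
        intro i j
        simp [V', vecMulVec_apply, one_apply, Pi.single_apply]
      have hL' : ∀ i j, L' i j = (if i = j then 1 else 0) + (if i = q then w j else 0) := by
        intro i j
        simp [L', vecMulVec_apply, one_apply, Pi.single_apply]
      have hV1 : MemN1 V' := by
        refine ⟨⟨fun i => ?_, fun i j h => ?_⟩, fun i j h => memO1_iff_ordGE.2 ?_⟩
        · rw [hV']; split_ifs with h1 h2 <;> simp_all
        · rw [hV', if_neg h.ne', zero_add]
          split_ifs with h1
          · exact hv0 i (h1 ▸ h.le)
          · rfl
        · rw [hV', if_neg h, zero_add]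
          split_ifs
          exacts [hv i, ordGE_zero 1]
      have hL1 : IsLowerUni L' := by
        refine ⟨fun i => ?_, fun i j h => ?_⟩
        · rw [hL']; split_ifs with h1 h2 <;> simp_all
        · rw [hL', if_neg h.ne, zero_add]
          split_ifs with h1
          · exact hw0 j (h1 ▸ h.le)
          · rfl
      have hent : ∀ i j, (V' * N * L') i j =
          N i j + v i * N q j + (N i q + v i * N q q) * w j := by
        intro i j
        have h1 : ∀ i j, (V' * N) i j = N i j + v i * N q j := by
          intro i j
          simp [mul_apply, hV', add_mul, Finset.sum_add_distrib]
        simp [mul_apply (M := V' * N), h1, hL', mul_add, Finset.sum_add_distrib]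
      have hassoc : V' * V * M * (L * L') = V' * N * L' := by
        simp only [hNdef, mul_assoc]
      refine ⟨V' * V, L * L', hV1.mul hV, hL.mul hL1, ?_, ?_⟩
      · have hvN : ∀ i j, OrdGE 1 (v i * N q j) := fun i j => (hv i).mul (hN.1 q j)
        have hNw : ∀ i j, i ≤ j → OrdGE 1 ((N i q + v i * N q q) * w j) := by
          intro i j hij
          by_cases hj : j < q
          · exact ((hN.2.1 i q (hij.trans_lt hj)).add (hvN i q)).mul (hw j)
          · rw [hw0 j (not_lt.1 hj), mul_zero]
            exact ordGE_zero 1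
        rw [hassoc]
        refine ⟨fun i j => ?_, fun i j hij => ?_, fun i => ?_⟩
        · rw [hent]
          exact ((hN.1 i j).add ((hvN i j).mono zero_le_one)).add
            (((hN.1 i q).add ((hvN i q).mono zero_le_one)).mul (hw j))
        · rw [hent]
          exact ((hN.2.1 i j hij).add (hvN i j)).add (hNw i j hij.le)
        · rw [hent, add_assoc, add_sub_right_comm]
          exact (hN.2.2 i).add ((hvN i i).add (hNw i i le_rfl))
      · rw [hassoc]
        intro i j hij h
        rw [hent]
        rcases lt_trichotomy q i with hi | hi | hi
        · have hi' : m - (d + 1) < (i : ℕ) := hi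
          rw [hz i j hij (Or.inl (by omega)), hv0 i hi.le, hz i q hi.ne' (Or.inl (by omega))]
          ring
        · subst hi
          rcases lt_or_gt_of_ne hij with hj | hj
          · have hj' : m - (d + 1) < (j : ℕ) := hj
            rw [hz q j hij (Or.inr (by omega)), hv0 q le_rfl, hw0 j hj.le]
            ring
          · simp only [hv0 q le_rfl, w, if_pos hj]
            field_simp
            ring
        · have hi' : (i : ℕ) < m - (d + 1) := hi
          have hqj : m - (d + 1) ≤ (j : ℕ) := by omega
          rcases eq_or_lt_of_le (show q ≤ j from hqj) with hj | hj
          · subst hj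
            simp only [hw0 q le_rfl, v, if_pos hi]
            field_simp
            ring
          · have hj' : m - (d + 1) < (j : ℕ) := hj
            rw [hz i j hij (Or.inr (by omega)), hz q j hj.ne (Or.inr (by omega)), hw0 j hj.le]
            ring
  obtain ⟨V, L, hV, hL, hN, hz⟩ := key m le_rfl
  exact ⟨V, L, hV, hL, fun i j h => hz i j h (Or.inl (by omega)),
    fun i => memO1_iff_ordGE.2 (hN.2.2 i)⟩

end Factorization

section MainTheorem

variable {n : ℕ}

theorem MemT1.exists_diagonal {D : Matrix (Fin n) (Fin n) K} (hD : MemT1 D) :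
    ∃ δ : Fin n → K, D = diagonal δ ∧ ∀ i, OrdGE 1 (δ i - 1) := by
  refine ⟨fun i => D i i, ?_, fun i => memO1_iff_ordGE.1 (hD.2 i)⟩
  ext i j
  by_cases h : i = j
  · rw [h, diagonal_apply_eq]
  · rw [diagonal_apply_ne _ h, hD.1 i j h]

theorem memT1_diagonal {δ : Fin n → K} (hδ : ∀ i, OrdGE 1 (δ i - 1)) : MemT1 (diagonal δ) :=
  ⟨fun _ _ h => diagonal_apply_ne _ h, fun i => by
    rw [diagonal_apply_eq]; exact memO1_iff_ordGE.2 (hδ i)⟩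

/-- For `y` of the shape of `τ_α(y(p,e,b,g))`, with nontrivial block in rows and columns
`s, …, r`, and `v ∈ N₁[[t⁻¹]]` supported on the same block, the matrix `y · v · t^α` reduces to a
lower unitriangular matrix after a lower unitriangular change of columns of `y · v`. -/
theorem exists_reducesToLowerUni {s r : Fin n} (hsr : s < r) {y v : Matrix (Fin n) (Fin n) K}
    {E F : K} {b τ : Fin n → K}
    (hys : ∀ j, y s j = if j = r then E else 0)
    (hym : ∀ i j, i ≠ s → i ≠ r →
      y i j = (if i = j then 1 else 0) + if j = r then b i else 0)
    (hb : ∀ i, OrdGE 0 (b i)) (hb0 : ∀ i, i < s → b i = 0)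
    (hyr : ∀ j, j ≠ r → OrdGE 0 (y r j)) (hyr0 : ∀ j, j < s ∨ r < j → y r j = 0)
    (hyrs : y r s = F) (hyrr : OrdGE 1 (y r r * tK⁻¹ - 1))
    (hE : OrdGE 0 E) (hEF : E * F = -1) (hF : OrdGE 0 F)
    (hv : MemN1 v) (hv0 : ∀ i j, i < j → ¬(s ≤ i ∧ j ≤ r) → v i j = 0)
    (hτs : τ s = tK) (hτr : τ r = tK⁻¹) (hτ : ∀ i, i ≠ s → i ≠ r → τ i = 1) :
    ∃ L, IsLowerUni L ∧ ReducesToLowerUni (y * v * L * diagonal τ) := by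
  have hvr : ∀ j, v r j = if j = r then 1 else 0 := by
    intro j
    rcases lt_trichotomy j r with h | h | h
    · rw [hv.1.2 r j h, if_neg h.ne]
    · rw [h, hv.1.1, if_pos rfl]
    · rw [hv0 r j h (fun h' => absurd h'.2 (not_le.2 h)), if_neg h.ne']
  set X := y * v with hX
  have hXs : ∀ j, X s j = if j = r then E else 0 := by
    intro j
    simp [hX, mul_apply, hys, hvr]
  have hXm : ∀ i j, i ≠ s → i ≠ r → X i j = v i j + if j = r then b i else 0 := by
    intro i j his hir
    simp [hX, mul_apply, hym i _ his hir, add_mul, Finset.sum_add_distrib, hvr]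
  have hXr : ∀ j, j ≠ r → OrdGE 0 (X r j) := by
    intro j hj
    rw [hX, mul_apply]
    refine OrdGE.sum fun l _ => ?_
    by_cases hl : l = r
    · rw [hl, hvr, if_neg hj, mul_zero]; exact ordGE_zero 0
    · exact (hyr l hl).mul (hv.ordGE_zero l j)
  have hXr0 : ∀ j, r < j → X r j = 0 := by
    intro j hj
    rw [hX, mul_apply]
    refine Finset.sum_eq_zero fun l _ => ?_
    rcases lt_or_ge r l with h | h
    · rw [hyr0 l (Or.inr h), zero_mul]
    · rw [hv0 l j (h.trans_lt hj) (fun h' => absurd h'.2 (not_le.2 hj)), mul_zero]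
  have hXrs : X r s = F := by
    rw [hX, mul_apply, Finset.sum_eq_single s, hyrs, hv.1.1, mul_one]
    · intro l _ hl
      rcases lt_or_gt_of_ne hl with h | h
      · rw [hyr0 l (Or.inl h), zero_mul]
      · rw [hv.1.2 l s h, mul_zero]
    · simp
  have hXrr : OrdGE 1 (X r r * tK⁻¹ - 1) := by
    rw [hX, mul_apply, ← Finset.add_sum_erase _ _ (Finset.mem_univ r), hv.1.1, mul_one,
      add_mul, add_sub_right_comm]
    refine hyrr.add (OrdGE.mul (a := 0) (OrdGE.sum fun l hl => ?_) ordGE_inv_tK)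
    exact (hyr l (Finset.ne_of_mem_erase hl)).mul (hv.ordGE_zero l r)
  have hP := hXrr.inv_sub_one
  have ht := tK_ne_zero
  have hQ0 : X r r ≠ 0 := left_ne_zero_of_mul (ne_zero_of_sub_one hXrr)
  have hQi : (X r r)⁻¹ = (X r r * tK⁻¹)⁻¹ * tK⁻¹ := by field_simp
  have hQ1 : OrdGE 1 (X r r)⁻¹ := by
    rw [hQi]; exact hP.of_sub_one.mul ordGE_inv_tK
  let w : Fin n → K := fun j => if j < r then -(X r j * (X r r)⁻¹) else 0
  have hw : ∀ j, OrdGE 1 (w j) := by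
    intro j
    simp only [w]
    split_ifs with h
    · exact ((hXr j h.ne).mul hQ1).neg
    · exact ordGE_zero 1
  have hw0 : ∀ j, r ≤ j → w j = 0 := fun j h => if_neg (not_lt.2 h)
  let L : Matrix (Fin n) (Fin n) K := 1 + vecMulVec (Pi.single r 1) w
  have hL : ∀ i j, L i j = (if i = j then 1 else 0) + (if i = r then w j else 0) := by
    intro i j
    simp [L, vecMulVec_apply, one_apply, Pi.single_apply]
  have hL1 : IsLowerUni L := by
    refine ⟨fun i => ?_, fun i j h => ?_⟩
    · rw [hL, if_pos rfl, add_eq_left]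
      split_ifs with h1
      · exact hw0 i h1.ge
      · rfl
    · rw [hL, if_neg h.ne, zero_add]
      split_ifs with h1
      · exact hw0 j (h1 ▸ h.le)
      · rfl
  have hM : ∀ i j, (X * L * diagonal τ) i j = (X i j + X i r * w j) * τ j := by
    intro i j
    rw [mul_diagonal]
    simp [mul_apply (M := X), hL, mul_add, Finset.sum_add_distrib]
  have hXir : ∀ i, i ≠ r → OrdGE 0 (X i r) := by
    intro i hi
    by_cases his : i = s
    · rw [his, hXs, if_pos rfl]; exact hE
    · rw [hXm i r his hi, if_pos rfl]
      exact (hv.ordGE_zero i r).add (hb i)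
  have claim : ∀ i j, (i = j ∧ OrdGE 1 ((X i j + X i r * w j) * τ j - 1)) ∨
      (i ≠ j ∧ OrdGE 1 ((X i j + X i r * w j) * τ j)) ∨
      (j < i ∧ OrdGE 0 ((X i j + X i r * w j) * τ j)) := by
    intro i j
    rcases lt_trichotomy j r with hj | hj | hj
    · by_cases hir : i = r
      · refine Or.inr (Or.inl ⟨hir ▸ hj.ne', ?_⟩)
        have : X i j + X i r * w j = 0 := by
          simp only [hir, w, if_pos hj]
          field_simp
          ring
        rw [this, zero_mul]
        exact ordGE_zero 1
      · by_cases hjs : j = s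
        · subst hjs
          by_cases hij : i = j
          · subst hij
            refine Or.inl ⟨rfl, ?_⟩
            have : (X i i + X i r * w i) * τ i = (X r r * tK⁻¹)⁻¹ := by
              simp only [w, if_pos hj, hτs, hXrs, hQi, hXs, if_neg hj.ne, if_true]
              field_simp
              linear_combination -hEF
            rw [this]
            exact hP
          · have hw' : X i r * w j * tK = -(X i r * (F * (X r r * tK⁻¹)⁻¹)) := by
              simp only [w, if_pos hj, hXrs, hQi]
              field_simp
            rcases lt_or_gt_of_ne hij with h | h
            · refine Or.inr (Or.inl ⟨hij, ?_⟩)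
              have h1 : ∀ l, i < l → v i l = 0 :=
                fun l hl => hv0 i l hl (fun h' => absurd h'.1 (not_le.2 h))
              rw [hXm i r hij hir, hXm i j hij hir, h1 j h, h1 r (h.trans hj), hb0 i h]
              simp [ordGE_zero]
            · refine Or.inr (Or.inr ⟨h, ?_⟩)
              rw [hXm i j hij hir, hv.1.2 i j h, if_neg hj.ne, add_zero, zero_add, hτs, hw']
              exact ((hXir i hir).mul (hF.mul hP.of_sub_one)).neg
        · rw [hτ j hjs hj.ne, mul_one]
          have h1 : OrdGE 1 (X i r * w j) := (hXir i hir).mul (hw j)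
          by_cases his : i = s
          · refine Or.inr (Or.inl ⟨fun h => hjs (h ▸ his), ?_⟩)
            rw [his, hXs j, if_neg hj.ne, zero_add, ← his]
            exact h1
          · rw [hXm i j his hir, if_neg hj.ne, add_zero]
            by_cases hij : i = j
            · refine Or.inl ⟨hij, ?_⟩
              subst hij
              rw [hv.1.1, add_sub_cancel_left]
              exact h1
            · exact Or.inr (Or.inl ⟨hij, (hv.ordGE hij).add h1⟩)
    · subst hj
      rw [hw0 j le_rfl, mul_zero, add_zero, hτr]
      by_cases hij : i = j
      · subst hij
        exact Or.inl ⟨rfl, hXrr⟩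
      · exact Or.inr (Or.inl ⟨hij, (hXir i hij).mul ordGE_inv_tK⟩)
    · rw [hw0 j hj.le, mul_zero, add_zero, hτ j (hsr.trans hj).ne' hj.ne', mul_one]
      by_cases his : i = s
      · refine Or.inr (Or.inl ⟨his ▸ (hsr.trans hj).ne, ?_⟩)
        rw [his, hXs, if_neg hj.ne']
        exact ordGE_zero 1
      · by_cases hir : i = r
        · refine Or.inr (Or.inl ⟨hir ▸ hj.ne, ?_⟩)
          rw [hir, hXr0 j hj]
          exact ordGE_zero 1
        · rw [hXm i j his hir, if_neg hj.ne', add_zero]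
          by_cases hij : i = j
          · refine Or.inl ⟨hij, ?_⟩
            rw [hij, hv.1.1, sub_self]
            exact ordGE_zero 1
          · exact Or.inr (Or.inl ⟨hij, hv.ordGE hij⟩)
  refine ⟨L, hL1, fun i j => ?_, fun i j hij => ?_, fun i => ?_⟩
  · rw [hM]
    rcases claim i j with h | h | h
    exacts [h.2.of_sub_one, h.2.mono zero_le_one, h.2]
  · rw [hM]
    rcases claim i j with h | h | h
    exacts [absurd h.1 hij.ne, h.2, absurd h.1 (not_lt.2 hij.le)]
  · rw [hM]
    rcases claim i i with h | h | h
    exacts [h.2, absurd rfl h.1, absurd h.1 (lt_irrefl i)]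

/-- If `y` is block triangular and `y · v · t^α` can be reduced as above for every block diagonal
`v ∈ N₁[[t⁻¹]]`, then multiplication by `y` maps `Gr_{μ+α}` to `Gr_μ`, up to `N₋[t]` on the right
and, on the left, elements of `N[t]` with trivial diagonal blocks. -/
theorem exists_mul_mem_grSlice {β : Fin n → ℕ} (hβ : Monotone β) {y : Matrix (Fin n) (Fin n) K}
    (hy : y.BlockTriangular β) {τ : Fin n → K} (hτ : ∀ i, τ i ≠ 0)
    (hred : ∀ v : Matrix (Fin n) (Fin n) K, MemN1 v → (∀ i j, β i ≠ β j → v i j = 0) →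
      ∃ L, IsLowerUni L ∧ ReducesToLowerUni (y * v * L * diagonal τ))
    {μ ν : Fin n → ℤ} (hμν : ∀ i, tK ^ ν i = τ i * tK ^ μ i)
    {y₂ : Matrix (Fin n) (Fin n) K} (hy₂ : y₂ ∈ GrSlice ν) :
    ∃ a c, MemNpoly a ∧ (∀ i j, i ≠ j → β i = β j → a i j = 0) ∧ MemNnegPoly c ∧
      a * (y * y₂) * c ∈ GrSlice μ := by
  obtain ⟨u, h, l, hu, hh, hl, rfl⟩ := hy₂
  obtain ⟨χ, rfl, hχ⟩ := hh.exists_diagonal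
  let v : Matrix (Fin n) (Fin n) K := fun i j => if β i = β j then u i j else 0
  have hvu : ∀ i j, β i = β j → u i j = v i j := fun i j hij => (if_pos hij).symm
  have hvz : ∀ i j, β i ≠ β j → v i j = 0 := fun i j hij => if_neg hij
  have hv : MemN1 v := by
    refine ⟨⟨fun i => (hvu i i rfl).symm.trans (hu.1.1 i), fun i j hij => ?_⟩, fun i j hij => ?_⟩
    all_goals by_cases hb : β i = β j
    · rw [← hvu i j hb, hu.1.2 i j hij]
    · exact hvz i j hb
    · rw [← hvu i j hb]; exact hu.2 i j hij
    · rw [hvz i j hb]; exact fun _ _ => HahnSeries.coeff_zero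
  obtain ⟨L, hL, hred⟩ := hred v hv hvz
  obtain ⟨V, Z, hV, hZ, hD⟩ := hred.exists_gauss
  obtain ⟨δ, hδ, hδ1⟩ := hD.exists_diagonal
  have hdet : y.det ≠ 0 := by
    have h1 : (V * (y * v * L * diagonal τ) * Z).det ≠ 0 := by
      rw [hδ, det_diagonal]
      exact Finset.prod_ne_zero_iff.2 fun i _ => ne_zero_of_sub_one (hδ1 i)
    intro h2
    simp [det_mul, h2] at h1
  have hyu : IsUnit y.det := isUnit_iff_ne_zero.2 hdet
  have := invertibleOfIsUnitDet y hyu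
  have hyi : y⁻¹.BlockTriangular β := blockTriangular_inv_of_blockTriangular hy
  have hup : ∀ {M : Matrix (Fin n) (Fin n) K}, IsUpperUni M → M.BlockTriangular β :=
    fun hM => hM.blockTriangular_of_monotone hβ
  have hvy : (v⁻¹ * y⁻¹).BlockTriangular β := (hup hv.1.inv).mul hyi
  set ρ := y * u * (v⁻¹ * y⁻¹) with hρdef
  have hρB : ρ.BlockTriangular β := (hy.mul (hup hu.1)).mul hvy
  have hyv1 : y * v * (v⁻¹ * y⁻¹) = 1 := by
    rw [mul_assoc, mul_nonsing_inv_cancel_left _ _ hv.1.isUnit, mul_nonsing_inv _ hyu]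
  have hρ1 : ∀ i j, β i = β j → ρ i j = (1 : Matrix (Fin n) (Fin n) K) i j := by
    rw [← hyv1]
    exact blockTriangular_mul_congr (hy.mul (hup hu.1)) (hy.mul (hup hv.1)) hvy hvy
      (blockTriangular_mul_congr hy hy (hup hu.1) (hup hv.1) (fun _ _ _ => rfl) hvu)
      (fun _ _ _ => rfl)
  have hρ : IsUpperUni ρ := by
    refine ⟨fun i => (hρ1 i i rfl).trans (one_apply_eq i), fun i j hij => ?_⟩
    rcases (hβ hij.le).lt_or_eq with h | h
    · exact hρB h
    · rw [hρ1 i j h.symm, one_apply_ne hij.ne']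
  obtain ⟨a, ha, hau⟩ := (hρ.mul hV.1.inv).exists_memNpoly_mul
  have haV : a * (ρ * V⁻¹) * V = a * ρ := by
    rw [mul_assoc, nonsing_inv_mul_cancel_right _ _ hV.1.isUnit]
  have haβ : ∀ i j, β i = β j → (a * (ρ * V⁻¹) * V) i j = a i j := by
    rw [haV]
    have := blockTriangular_mul_congr (hup ha.1) (hup ha.1) hρB (hup isUpperUni_one)
      (fun _ _ _ => rfl) hρ1
    simpa using this
  let η : Fin n → K := fun i => χ i * tK ^ ν i
  have hη : ∀ i, η i ≠ 0 := fun i =>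
    mul_ne_zero (ne_zero_of_sub_one (hχ i)) (zpow_ne_zero _ tK_ne_zero)
  let ηi : Fin n → K := fun i => (η i)⁻¹
  let τi : Fin n → K := fun i => (τ i)⁻¹
  have hΛ : IsLowerUni (diagonal ηi * (diagonal τ * Z⁻¹ * diagonal τi * L⁻¹) * diagonal η * l) :=
    (((hZ.inv.conj_diagonal fun i => mul_inv_cancel₀ (hτ i)).mul hL.inv).conj_diagonal
      fun i => inv_mul_cancel₀ (hη i)).mul hl.1
  set Λ := diagonal ηi * (diagonal τ * Z⁻¹ * diagonal τi * L⁻¹) * diagonal η * l with hΛdef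
  obtain ⟨c, hc, hcl⟩ := hΛ.exists_mul_memNnegPoly
  have hττ : diagonal τ * diagonal τi = 1 := by
    rw [diagonal_mul_diagonal, ← diagonal_one]
    exact congrArg diagonal (funext fun i => mul_inv_cancel₀ (hτ i))
  have hyv : y * v = V⁻¹ * diagonal δ * Z⁻¹ * diagonal τi * L⁻¹ := by
    rw [← hδ]
    simp only [mul_assoc]
    rw [nonsing_inv_mul_cancel_left _ _ hV.1.isUnit, mul_nonsing_inv_cancel_left _ _ hZ.isUnit,
      ← mul_assoc (diagonal τ), hττ, one_mul, mul_nonsing_inv _ hL.isUnit, mul_one]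
  have hyu' : y * u = ρ * (y * v) := by
    rw [hρdef]
    simp only [mul_assoc]
    rw [nonsing_inv_mul_cancel_left _ _ hyu, nonsing_inv_mul _ hv.1.isUnit, mul_one]
  have hdiag : diagonal δ * diagonal χ * tPow μ * diagonal ηi * diagonal τ = diagonal δ := by
    simp only [tPow, diagonal_mul_diagonal]
    refine congrArg diagonal (funext fun i => ?_)
    have h1 := ne_zero_of_sub_one (hχ i)
    have h2 := zpow_ne_zero (μ i) tK_ne_zero
    have h3 := hτ i
    simp only [ηi, η, hμν]
    field_simp
  refine ⟨a, c, ha, fun i j hij hb => ?_, hc, a * (ρ * V⁻¹), diagonal δ * diagonal χ, Λ * c, hau,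
    ?_, hcl, ?_⟩
  · refine eq_zero_of_memPoly_of_memO1 (ha.2 i j) ?_
    rw [← haβ i j hb]
    exact (hau.mul hV).2 i j hij
  · rw [diagonal_mul_diagonal]
    exact memT1_diagonal fun i => (hδ1 i).mul_sub_one (hχ i)
  · have hηd : diagonal χ * tPow ν = diagonal η := diagonal_mul_diagonal _ _
    have h1 : y * (u * diagonal χ * tPow ν * l) =
        ρ * V⁻¹ * (diagonal δ * Z⁻¹ * diagonal τi * L⁻¹ * diagonal η * l) := by
      rw [← hηd]
      simp only [← mul_assoc]
      rw [hyu', hyv]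
      simp only [← mul_assoc]
    have h2 : diagonal δ * Z⁻¹ * diagonal τi * L⁻¹ * diagonal η * l =
        diagonal δ * diagonal χ * tPow μ * Λ := by
      rw [hΛdef]
      simp only [← mul_assoc]
      rw [hdiag]
    rw [h1, h2]
    simp only [mul_assoc]

end MainTheorem

/-- For `y₁ = τ_α(y(p,e,b,g)) ∈ Gr⁰_{−α}` and `y₂ ∈ Gr_{μ+α}` there
exist `a ∈ N^α[t]` and `c ∈ N₋[t]` with `a·y₁·y₂·c ∈ Gr_μ`. -/
theorem statement8 (n r₁ r₂ k : ℕ) (hn : 2 ≤ n) (hr1 : 1 ≤ r₁) (hrr : r₁ ≤ r₂)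
    (hrn : r₂ < n) (hk : k = r₂ - r₁ + 1) (μ : Fin n → ℤ)
    (p e : ℂ) (he : e ≠ 0) (b g : Fin (k-1) → ℂ)
    (y₂ : Matrix (Fin n) (Fin n) K) (hy₂ : y₂ ∈ GrSlice (addAlpha n r₁ r₂ μ)) :
    ∃ a c : Matrix (Fin n) (Fin n) K,
      MemNalphaPoly n r₁ k a ∧ MemNnegPoly c ∧
      a * (blockEmbed n r₁ k (ymat k p e b g) * y₂) * c ∈ GrSlice μ := by
  have hk' : r₁ - 1 + k = r₂ := by omega
  let s : Fin n := ⟨r₁ - 1, by omega⟩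
  let r : Fin n := ⟨r₂, hrn⟩
  have hsr : s < r := Fin.lt_def.2 (by simp only [s, r]; omega)
  let y := blockEmbed n r₁ k (ymat k p e b g)
  let β : Fin n → ℕ := fun i => if r₁ - 1 ≤ (i : ℕ) ∧ (i : ℕ) ≤ r₂ then r₁ - 1 else i
  have hβ : Monotone β := by
    intro i j hij
    have : (i : ℕ) ≤ j := hij
    simp only [β]
    split_ifs <;> omega
  have hβin : ∀ i j : Fin n, r₁ - 1 ≤ (i : ℕ) → (i : ℕ) ≤ r₂ → r₁ - 1 ≤ (j : ℕ) →
      (j : ℕ) ≤ r₂ → β i = β j := by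
    intro i j h1 h2 h3 h4
    simp only [β, if_pos (And.intro h1 h2), if_pos (And.intro h3 h4)]
  have hyin : ∀ i j : Fin n, ∀ hi : r₁ - 1 ≤ (i : ℕ) ∧ (i : ℕ) ≤ r₂,
      ∀ hj : r₁ - 1 ≤ (j : ℕ) ∧ (j : ℕ) ≤ r₂,
      y i j = ymat k p e b g ⟨(i : ℕ) - (r₁ - 1), by omega⟩ ⟨(j : ℕ) - (r₁ - 1), by omega⟩ :=
    fun i j hi hj => dif_pos ⟨hi.1, by omega, hj.1, by omega⟩
  have hyout : ∀ i j : Fin n, ¬((r₁ - 1 ≤ (i : ℕ) ∧ (i : ℕ) ≤ r₂) ∧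
      (r₁ - 1 ≤ (j : ℕ) ∧ (j : ℕ) ≤ r₂)) → y i j = if i = j then 1 else 0 :=
    fun i j h => dif_neg fun h' => h ⟨⟨h'.1, by omega⟩, h'.2.2.1, by omega⟩
  have hy : y.BlockTriangular β := by
    intro i j hij
    rw [hyout i j, if_neg]
    · rintro rfl
      exact lt_irrefl _ hij
    · intro h
      exact absurd (hβin i j h.1.1 h.1.2 h.2.1 h.2.2) hij.ne'
  let τ : Fin n → K := fun i => tK ^ alphaCo n r₁ r₂ i
  have hτ : ∀ i, τ i ≠ 0 := fun i => zpow_ne_zero _ tK_ne_zero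
  have hμν : ∀ i, tK ^ addAlpha n r₁ r₂ μ i = τ i * tK ^ μ i := by
    intro i
    rw [addAlpha, zpow_add₀ tK_ne_zero, mul_comm]
  have hred : ∀ v : Matrix (Fin n) (Fin n) K, MemN1 v → (∀ i j, β i ≠ β j → v i j = 0) →
      ∃ L, IsLowerUni L ∧ ReducesToLowerUni (y * v * L * diagonal τ) := by
    intro v hv hvβ
    let bb : Fin n → K := fun i =>
      if h : r₁ - 1 < (i : ℕ) ∧ (i : ℕ) < r₂ then Cc (b ⟨r₂ - i - 1, by omega⟩) else 0
    refine exists_reducesToLowerUni hsr (E := Cc e) (F := Cc (-e⁻¹)) (b := bb)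
      ?_ ?_ ?_ ?_ ?_ ?_ ?_ ?_ (ordGE_Cc e) ?_ (ordGE_Cc _) hv ?_ ?_ ?_ ?_
    · intro j
      by_cases hj : r₁ - 1 ≤ (j : ℕ) ∧ (j : ℕ) ≤ r₂
      · rw [hyin s j ⟨le_rfl, by simp only [s]; omega⟩ hj]
        simp only [ymat, s, r, Fin.ext_iff]
        rw [dif_pos (by omega)]
        split_ifs <;> first | rfl | omega
      · rw [hyout s j (fun h => hj h.2), if_neg, if_neg]
        all_goals simp only [s, r, Fin.ext_iff]; omega
    · intro i j his hir
      have his' : (i : ℕ) ≠ r₁ - 1 := fun h => his (Fin.ext h)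
      have hir' : (i : ℕ) ≠ r₂ := fun h => hir (Fin.ext h)
      by_cases hi : r₁ - 1 < (i : ℕ) ∧ (i : ℕ) < r₂
      · by_cases hj : r₁ - 1 ≤ (j : ℕ) ∧ (j : ℕ) ≤ r₂
        · rw [hyin i j ⟨by omega, by omega⟩ hj]
          simp only [ymat, r, Fin.ext_iff, bb]
          rw [dif_neg (by omega), dif_neg (by omega), dif_pos hi]
          split_ifs
          any_goals omega
          any_goals simp
          congr 3
          omega
        · rw [hyout i j (fun h => hj h.2), if_neg (c := j = r), add_zero]
          simp only [r, Fin.ext_iff]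
          omega
      · rw [hyout i j (fun h => by omega)]
        simp only [bb, dif_neg hi, ite_self, add_zero]
    · intro i
      simp only [bb]
      split_ifs
      exacts [ordGE_Cc _, ordGE_zero 0]
    · intro i hi
      have : (i : ℕ) < r₁ - 1 := hi
      exact dif_neg (by omega)
    · intro j hj
      have hj' : (j : ℕ) ≠ r₂ := fun h => hj (Fin.ext h)
      by_cases hjb : r₁ - 1 ≤ (j : ℕ) ∧ (j : ℕ) ≤ r₂
      · rw [hyin r j ⟨by simp only [r]; omega, le_rfl⟩ hjb]
        simp only [ymat, r]
        rw [dif_neg (by omega), dif_pos (by omega)]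
        split_ifs
        any_goals omega
        all_goals exact ordGE_Cc _
      · rw [hyout r j (fun h => hjb h.2), if_neg (Ne.symm hj)]
        exact ordGE_zero 0
    · intro j hj
      have hj' : (j : ℕ) < r₁ - 1 ∨ r₂ < (j : ℕ) := hj
      rw [hyout r j (fun h => by omega), if_neg]
      simp only [r, Fin.ext_iff]
      omega
    · rw [hyin r s ⟨by simp only [r]; omega, le_rfl⟩ ⟨le_rfl, by simp only [s]; omega⟩]
      simp only [ymat, r, s]
      rw [dif_neg (by omega), dif_pos (by omega), dif_pos (by omega)]
    · rw [hyin r r ⟨by simp only [r]; omega, le_rfl⟩ ⟨by simp only [r]; omega, le_rfl⟩]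
      simp only [ymat, r]
      rw [dif_neg (by omega), dif_pos (by omega), dif_neg (by omega), dif_pos (by omega), sub_mul,
        mul_inv_cancel₀ tK_ne_zero, sub_sub_cancel_left]
      exact ((ordGE_Cc _).mul ordGE_inv_tK).neg
    · have h1 : Cc e * Cc (-e⁻¹) = Cc (e * -e⁻¹) := (map_mul HahnSeries.C _ _).symm
      rw [h1, mul_neg, mul_inv_cancel₀ he]
      simp [Cc]
    · intro i j hij h
      refine hvβ i j fun hb => h ?_
      have hij' : (i : ℕ) < j := hij
      simp only [β] at hb
      change r₁ - 1 ≤ (i : ℕ) ∧ (j : ℕ) ≤ r₂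
      split_ifs at hb <;> omega
    · simp [τ, s, alphaCo]
    · have : r₂ ≠ r₁ - 1 := by omega
      simp [τ, r, alphaCo, this]
    · intro i his hir
      have his' : (i : ℕ) ≠ r₁ - 1 := fun h => his (Fin.ext h)
      have hir' : (i : ℕ) ≠ r₂ := fun h => hir (Fin.ext h)
      simp [τ, alphaCo, his', hir']
  obtain ⟨a, c, ha, ha0, hc, hac⟩ := exists_mul_mem_grSlice hβ hy hτ hred hμν hy₂
  refine ⟨a, c, ⟨⟨ha.1, fun i j h1 h2 h3 h4 => ?_⟩, ha.2⟩, hc, hac⟩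
  split_ifs with hij
  · rw [hij, ha.1.1]
  · exact ha0 i j hij (hβin i j h1 (by omega) h3 (by omega))

end
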